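/- arXiv:0907.4038 — 5 statements merged into one kernel-verified Lean document; each statement's English description precedes it below -/
import Mathlib

section
/- Let n ≥ 2 be an integer, r₀ > 0, and let h : [r₀,∞) → (0,∞) be a C² function. Set A_h(r) = h'(r)/h(r) and K_h(r) = −h''(r)/h(r). Assume there exist a constant A₀ > 0 and a function ε : (r₀,∞) → (0,∞) with lim_{t→∞} ε(t) = 0 such that A₀/r ≤ A_h(r) ≤ ε(r)/√r for all r > r₀, and assume lim_{r→∞} r·K_h(r) = 0. Then for every μ ≥ 0 and every λ > 0, any C² function u : (r₀,∞) → ℝ satisfying −u''(x) + q(x)u(x) = λu(x) on (r₀,∞), where q(x) = ((n−1)(n−3)/4)·A_h(x)² − ((n−1)/2)·K_h(x) + μ/h(x)², and satisfying ∫_{r₀}^∞ u(x)² dx < ∞, vanishes identically on (r₀,∞). -/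
open Real Filter MeasureTheory Set

/-- A solution of `u'' = Q u` with vanishing Cauchy data at the right end point of an interval
vanishes at the left end point. -/
theorem eq_zero_of_cauchy_data_eq_zero {u v Q : ℝ → ℝ} {x X : ℝ} (hxX : x ≤ X)
    (hu : ∀ t ∈ Icc x X, HasDerivAt u (v t) t)
    (hv : ∀ t ∈ Icc x X, HasDerivAt v (Q t * u t) t)
    (hQ : ContinuousOn Q (Icc x X)) (huX : u X = 0) (hvX : v X = 0) : u x = 0 := by
  obtain ⟨B, hB⟩ := isCompact_Icc.exists_bound_of_continuousOn hQ
  have hder : ∀ t ∈ Icc x X, HasDerivAt (fun t => exp ((1 + B) * t) * (u t ^ 2 + v t ^ 2))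
      (exp ((1 + B) * t) * ((1 + B) * (u t ^ 2 + v t ^ 2) + 2 * (1 + Q t) * (u t * v t))) t := by
    intro t ht
    have h1 : HasDerivAt (fun t => exp ((1 + B) * t)) (exp ((1 + B) * t) * ((1 + B) * 1)) t :=
      ((hasDerivAt_id t).const_mul (1 + B)).exp
    refine (h1.mul (((hu t ht).pow 2).add ((hv t ht).pow 2))).congr_deriv ?_
    simp only [Pi.add_apply, Pi.pow_apply]
    push_cast
    ring
  have hmono : MonotoneOn (fun t => exp ((1 + B) * t) * (u t ^ 2 + v t ^ 2)) (Icc x X) := by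
    refine monotoneOn_of_deriv_nonneg (convex_Icc x X)
      (fun t ht => (hder t ht).continuousAt.continuousWithinAt)
      (fun t ht => (hder t (interior_subset ht)).differentiableAt.differentiableWithinAt) ?_
    intro t ht
    rw [(hder t (interior_subset ht)).deriv]
    have hb := hB t (interior_subset ht)
    rw [Real.norm_eq_abs, abs_le] at hb
    refine mul_nonneg (exp_pos _).le ?_
    nlinarith [mul_nonneg (by linarith : 0 ≤ B - Q t) (sq_nonneg (u t - v t)),
      mul_nonneg (by linarith : 0 ≤ B + Q t) (sq_nonneg (u t + v t)), sq_nonneg (u t + v t)]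
  have hle := hmono (left_mem_Icc.2 hxX) (right_mem_Icc.2 hxX) hxX
  simp only [huX, hvX] at hle
  have hle' : exp ((1 + B) * x) * (u x ^ 2 + v x ^ 2) ≤ 0 := by simpa using hle
  have := nonpos_of_mul_nonpos_right hle' (exp_pos _)
  exact pow_eq_zero_iff two_ne_zero |>.1 (by nlinarith [sq_nonneg (u x), sq_nonneg (v x)])

/-- A function whose square has derivative tending to infinity is not square integrable. -/
theorem not_integrableOn_sq_of_tendsto_mul_deriv {u v : ℝ → ℝ} {X : ℝ}
    (hu : ∀ t ∈ Ici X, HasDerivAt u (v t) t)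
    (huv : Tendsto (fun t => u t * v t) atTop atTop) :
    ¬ IntegrableOn (fun t => u t ^ 2) (Ioi X) := by
  intro hint
  obtain ⟨Y, hY⟩ := eventually_atTop.1 ((huv.eventually_ge_atTop 1).and (eventually_ge_atTop X))
  have hder : ∀ t ∈ Ici Y, HasDerivAt (fun t => u t ^ 2 - 2 * t) (2 * (u t * v t) - 2) t := by
    intro t ht
    refine (((hu t (hY t ht).2).pow 2).sub ((hasDerivAt_id t).const_mul 2)).congr_deriv ?_
    push_cast
    ring
  have hmono : MonotoneOn (fun t => u t ^ 2 - 2 * t) (Ici Y) := by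
    refine monotoneOn_of_deriv_nonneg (convex_Ici Y)
      (fun t ht => (hder t ht).continuousAt.continuousWithinAt)
      (fun t ht => (hder t (interior_subset ht)).differentiableAt.differentiableWithinAt) ?_
    intro t ht
    rw [(hder t (interior_subset ht)).deriv]
    linarith [(hY t (interior_subset ht)).1]
  have hone : IntegrableOn (fun _ => (1 : ℝ)) (Ioi (Y + 1)) := by
    refine Integrable.mono' (hint.mono_set (Ioi_subset_Ioi (by linarith [(hY Y le_rfl).2])))
      aestronglyMeasurable_const ?_
    refine (ae_restrict_iff' measurableSet_Ioi).2 (Eventually.of_forall fun t ht => ?_)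
    have ht' : Y + 1 < t := ht
    have := hmono (mem_Ici.2 le_rfl) (mem_Ici.2 (by linarith : Y ≤ t)) (by linarith)
    simp only at this
    rw [norm_one]
    nlinarith [sq_nonneg (u Y)]
  simp [integrableOn_const_iff] at hone

/-- Square integrable solutions of `u'' = (V + W - lam) u` have vanishing Cauchy data at `X`
if on `[X, ∞)` the potential `V` is small compared to `1 / t` and `W` is small and decreasing. -/
theorem cauchy_data_eq_zero_of_integrableOn_sq {u v V W W' : ℝ → ℝ} {lam X : ℝ}
    (hlam : 0 < lam) (hX : 0 < X)
    (hu : ∀ t ∈ Ici X, HasDerivAt u (v t) t)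
    (hv : ∀ t ∈ Ici X, HasDerivAt v ((V t + W t - lam) * u t) t)
    (hW : ∀ t ∈ Ici X, HasDerivAt W (W' t) t)
    (hW' : ∀ t ∈ Ici X, W' t ≤ 0)
    (hW0 : ∀ t ∈ Ici X, 0 ≤ W t) (hWlam : ∀ t ∈ Ici X, W t ≤ lam / 2)
    (hV : ∀ t ∈ Ici X, (t * V t) ^ 2 ≤ lam / 2) (hV1 : ∀ t ∈ Ici X, -1 ≤ V t)
    (hint : IntegrableOn (fun t => u t ^ 2) (Ioi X)) : u X = 0 ∧ v X = 0 := by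
  set F : ℝ → ℝ := fun t => t * (v t ^ 2 + (lam - W t) * u t ^ 2)
  have hFder : ∀ t ∈ Ici X, HasDerivAt F ((v t ^ 2 + (lam - W t) * u t ^ 2)
      + (2 * (t * V t) * (u t * v t) - t * W' t * u t ^ 2)) t := by
    intro t ht
    refine ((hasDerivAt_id t).mul (((hv t ht).pow 2).add
      (((hW t ht).const_sub lam).mul ((hu t ht).pow 2)))).congr_deriv ?_
    simp only [Pi.add_apply, Pi.pow_apply, Pi.mul_apply, id]
    push_cast
    ring
  have hFmono : MonotoneOn F (Ici X) := by
    refine monotoneOn_of_deriv_nonneg (convex_Ici X)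
      (fun t ht => (hFder t ht).continuousAt.continuousWithinAt)
      (fun t ht => (hFder t (interior_subset ht)).differentiableAt.differentiableWithinAt) ?_
    intro t ht
    replace ht := interior_subset ht
    rw [(hFder t ht).deriv]
    have ht0 : 0 ≤ t := hX.le.trans ht
    nlinarith [sq_nonneg (v t + t * V t * u t),
      mul_nonneg (sub_nonneg.2 (hV t ht)) (sq_nonneg (u t)),
      mul_nonneg (sub_nonneg.2 (hWlam t ht)) (sq_nonneg (u t)),
      mul_nonneg (mul_nonneg ht0 (neg_nonneg.2 (hW' t ht))) (sq_nonneg (u t))]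
  have hcont : ContinuousOn (fun t => u t ^ 2) (Ici X) :=
    fun t ht => ((hu t ht).continuousAt.pow 2).continuousWithinAt
  have hFX : F X ≤ 0 := by
    by_contra! hpos
    set G : ℝ → ℝ := fun t => u t * v t - F X * log t + (1 + 2 * lam) * ∫ s in X..t, u s ^ 2
    have hGder : ∀ t ∈ Ioi X, HasDerivAt G
        (v t * v t + u t * ((V t + W t - lam) * u t) - F X * t⁻¹ + (1 + 2 * lam) * u t ^ 2) t := by
      intro t ht
      have ht' : t ∈ Ici X := Ioi_subset_Ici_self ht
      have hI : HasDerivAt (fun t => ∫ s in X..t, u s ^ 2) (u t ^ 2) t := by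
        refine intervalIntegral.integral_hasDerivAt_right ?_ ?_ ((hu t ht').continuousAt.pow 2)
        · exact (hcont.mono (by rw [uIcc_of_le ht']; exact Icc_subset_Ici_self)).intervalIntegrable
        · exact (hcont.mono Ioi_subset_Ici_self).stronglyMeasurableAtFilter isOpen_Ioi t ht
      exact (((hu t ht').mul (hv t ht')).sub
        ((hasDerivAt_log (hX.trans ht).ne').const_mul (F X))).add (hI.const_mul (1 + 2 * lam))
    have hGmono : MonotoneOn G (Ici (X + 1)) := by
      have hsub : ∀ t ∈ Ici (X + 1), t ∈ Ioi X := fun t ht =>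
        mem_Ioi.2 (by linarith [mem_Ici.1 ht])
      refine monotoneOn_of_deriv_nonneg (convex_Ici _)
        (fun t ht => (hGder t (hsub t ht)).continuousAt.continuousWithinAt)
        (fun t ht => (hGder t (hsub t (interior_subset ht))).differentiableAt.differentiableWithinAt)
        ?_
      intro t ht
      replace ht := hsub t (interior_subset ht)
      have ht' : t ∈ Ici X := Ioi_subset_Ici_self ht
      rw [(hGder t ht).deriv]
      have ht0 : 0 < t := hX.trans ht
      have hFt : F X * t⁻¹ ≤ v t ^ 2 + (lam - W t) * u t ^ 2 := by
        rw [← div_eq_mul_inv, div_le_iff₀ ht0, mul_comm]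
        exact hFmono (mem_Ici.2 le_rfl) ht' ht'
      nlinarith [mul_nonneg (by linarith [hV1 t ht'] : 0 ≤ V t + 1) (sq_nonneg (u t)),
        mul_nonneg (hW0 t ht') (sq_nonneg (u t))]
    refine not_integrableOn_sq_of_tendsto_mul_deriv hu ?_ hint
    have hlog : Tendsto (fun t => F X * log t
        + (G (X + 1) - (1 + 2 * lam) * ∫ s in Ioi X, u s ^ 2)) atTop atTop :=
      tendsto_atTop_add_const_right _ _ (tendsto_log_atTop.const_mul_atTop hpos)
    refine tendsto_atTop_mono' _ ?_ hlog
    filter_upwards [eventually_ge_atTop (X + 1)] with t ht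
    have hGt := hGmono (mem_Ici.2 le_rfl) (mem_Ici.2 ht) ht
    have hIt : ∫ s in X..t, u s ^ 2 ≤ ∫ s in Ioi X, u s ^ 2 := by
      rw [intervalIntegral.integral_of_le (by linarith)]
      exact setIntegral_mono_set hint (Eventually.of_forall fun s => sq_nonneg (u s))
        Ioc_subset_Ioi_self.eventuallyLE
    have hGt' : G (X + 1) ≤ u t * v t - F X * log t + (1 + 2 * lam) * ∫ s in X..t, u s ^ 2 := hGt
    nlinarith
  have hE : v X ^ 2 + (lam - W X) * u X ^ 2 ≤ 0 := nonpos_of_mul_nonpos_right hFX hX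
  have hWX := hWlam X (mem_Ici.2 le_rfl)
  have hterm : lam / 2 * u X ^ 2 ≤ (lam - W X) * u X ^ 2 :=
    mul_le_mul_of_nonneg_right (by linarith) (sq_nonneg _)
  constructor
  · refine pow_eq_zero_iff two_ne_zero |>.1 (le_antisymm ?_ (sq_nonneg _))
    exact nonpos_of_mul_nonpos_right (by linarith [sq_nonneg (v X)] : lam / 2 * u X ^ 2 ≤ 0)
      (by positivity)
  · refine pow_eq_zero_iff two_ne_zero |>.1 (le_antisymm ?_ (sq_nonneg _))
    have : 0 ≤ lam / 2 * u X ^ 2 := by positivity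
    linarith

/-- A positive function with logarithmic derivative at least `a / r`, `a > 0`, is unbounded. -/
theorem tendsto_atTop_of_div_le_logDeriv {h h' : ℝ → ℝ} {a r₀ : ℝ} (ha : 0 < a) (hr₀ : 0 < r₀)
    (hh : ∀ r ∈ Ioi r₀, HasDerivAt h (h' r) r) (hpos : ∀ r ∈ Ioi r₀, 0 < h r)
    (hle : ∀ r ∈ Ioi r₀, a / r ≤ h' r / h r) : Tendsto h atTop atTop := by
  have hder : ∀ r ∈ Ioi r₀, HasDerivAt (fun r => log (h r) - a * log r)
      (h' r / h r - a * r⁻¹) r := fun r hr =>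
    ((hh r hr).log (hpos r hr).ne').sub ((hasDerivAt_log (hr₀.trans hr).ne').const_mul a)
  have hmono : MonotoneOn (fun r => log (h r) - a * log r) (Ioi r₀) := by
    refine monotoneOn_of_deriv_nonneg (convex_Ioi r₀)
      (fun t ht => (hder t ht).continuousAt.continuousWithinAt)
      (fun t ht => (hder t (interior_subset ht)).differentiableAt.differentiableWithinAt) ?_
    intro t ht
    rw [(hder t (interior_subset ht)).deriv, ← div_eq_mul_inv]
    linarith [hle t (interior_subset ht)]
  have hlog : Tendsto (fun r => log (h r)) atTop atTop := by
    refine tendsto_atTop_mono' _ ?_ (tendsto_atTop_add_const_right _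
      (log (h (r₀ + 1)) - a * log (r₀ + 1)) (tendsto_log_atTop.const_mul_atTop ha))
    filter_upwards [eventually_ge_atTop (r₀ + 1)] with r hr
    have := hmono (mem_Ioi.2 (by linarith : r₀ < r₀ + 1)) (mem_Ioi.2 (by linarith)) hr
    simp only at this
    linarith
  refine (tendsto_exp_atTop.comp hlog).congr' ?_
  filter_upwards [eventually_gt_atTop r₀] with r hr
  exact exp_log (hpos r hr)

/-- The first and second derivatives of a `C²` function on an open set. -/
theorem ContDiffOn.hasDerivAt_deriv_deriv {f : ℝ → ℝ} {s : Set ℝ} (hs : IsOpen s)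
    (hf : ContDiffOn ℝ 2 f s) :
    (∀ t ∈ s, HasDerivAt f (deriv f t) t) ∧ (∀ t ∈ s, HasDerivAt (deriv f) (deriv (deriv f) t) t)
      ∧ ContinuousOn (deriv (deriv f)) s := by
  have h1 : ContDiffOn ℝ 1 (deriv f) s := hf.deriv_of_isOpen hs (by norm_num)
  have h0 : ContDiffOn ℝ 0 (deriv (deriv f)) s := h1.deriv_of_isOpen hs (by norm_num)
  exact ⟨fun t ht => ((hf.differentiableOn (by norm_num)).differentiableAt
      (hs.mem_nhds ht)).hasDerivAt,
    fun t ht => ((h1.differentiableOn (by norm_num)).differentiableAt (hs.mem_nhds ht)).hasDerivAt,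
    h0.continuousOn⟩

/-- Theorem 1.3 of the paper, mode-by-mode form. -/
theorem stmt_2
    (n : ℕ) (hn : 2 ≤ n)
    (r₀ A₀ : ℝ) (hr₀ : 0 < r₀) (hA₀ : 0 < A₀)
    (h : ℝ → ℝ) (hh : ContDiffOn ℝ 2 h (Ici r₀))
    (hhpos : ∀ r ∈ Ici r₀, 0 < h r)
    (ε : ℝ → ℝ) (hεpos : ∀ t ∈ Ioi r₀, 0 < ε t)
    (hεlim : Filter.Tendsto ε Filter.atTop (nhds 0))
    (HA : ∀ r ∈ Ioi r₀,
      A₀ / r ≤ deriv h r / h r ∧ deriv h r / h r ≤ ε r / Real.sqrt r)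
    (HK : Filter.Tendsto (fun r => r * (-(deriv (deriv h) r) / h r))
      Filter.atTop (nhds 0)) :
    ∀ μ : ℝ, 0 ≤ μ → ∀ lam : ℝ, 0 < lam → ∀ u : ℝ → ℝ,
      ContDiffOn ℝ 2 u (Ioi r₀) →
      (∀ x ∈ Ioi r₀,
        -(deriv (deriv u) x) +
          ((n - 1 : ℝ) * (n - 3 : ℝ) / 4 * (deriv h x / h x) ^ 2
            - (n - 1 : ℝ) / 2 * (-(deriv (deriv h) x) / h x)
            + μ / h x ^ 2) * u x = lam * u x) →
      MeasureTheory.IntegrableOn (fun x => u x ^ 2) (Ioi r₀) →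
      ∀ x ∈ Ioi r₀, u x = 0 := by
  intro μ hμ lam hlam u hu hode hint
  obtain ⟨hh1, hh2, hh2c⟩ := (hh.mono Ioi_subset_Ici_self).hasDerivAt_deriv_deriv isOpen_Ioi
  obtain ⟨hu1, hu2, -⟩ := hu.hasDerivAt_deriv_deriv isOpen_Ioi
  have hpos : ∀ r ∈ Ioi r₀, 0 < h r := fun r hr => hhpos r (Ioi_subset_Ici_self hr)
  have hlim : Tendsto h atTop atTop :=
    tendsto_atTop_of_div_le_logDeriv hA₀ hr₀ hh1 hpos fun r hr => (HA r hr).1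
  set V : ℝ → ℝ := fun x => (n - 1 : ℝ) * (n - 3 : ℝ) / 4 * (deriv h x / h x) ^ 2
    - (n - 1 : ℝ) / 2 * (-(deriv (deriv h) x) / h x) with hVdef
  set W : ℝ → ℝ := fun x => μ / h x ^ 2 with hWdef
  have hu2' : ∀ t ∈ Ioi r₀, HasDerivAt (deriv u) ((V t + W t - lam) * u t) t := by
    intro t ht
    convert hu2 t ht using 1
    have := hode t ht
    simp only [hVdef, hWdef]
    linarith
  have hWder : ∀ t ∈ Ioi r₀, HasDerivAt W (-(2 * μ * deriv h t) / h t ^ 3) t := by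
    intro t ht
    have hne := (hpos t ht).ne'
    refine ((hasDerivAt_const t μ).div ((hh1 t ht).pow 2) (pow_ne_zero 2 hne)).congr_deriv ?_
    simp only [Pi.pow_apply]
    field_simp
    push_cast
    ring
  have hderiv_nonneg : ∀ t ∈ Ioi r₀, 0 ≤ deriv h t := by
    intro t ht
    have h1 : 0 ≤ deriv h t / h t := (div_pos hA₀ (hr₀.trans ht)).le.trans (HA t ht).1
    have h2 := mul_nonneg h1 (hpos t ht).le
    rwa [div_mul_cancel₀ _ (hpos t ht).ne'] at h2
  have hQcont : ContinuousOn (fun t => V t + W t - lam) (Ioi r₀) := by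
    have hhc : ContinuousOn h (Ioi r₀) := fun t ht => (hh1 t ht).continuousAt.continuousWithinAt
    have hh'c : ContinuousOn (deriv h) (Ioi r₀) :=
      fun t ht => (hh2 t ht).continuousAt.continuousWithinAt
    have hne : ∀ t ∈ Ioi r₀, h t ≠ 0 := fun t ht => (hpos t ht).ne'
    have hWc : ContinuousOn W (Ioi r₀) :=
      fun t ht => (hWder t ht).continuousAt.continuousWithinAt
    exact (((continuousOn_const.mul ((hh'c.div hhc hne).pow 2)).sub
      (continuousOn_const.mul (hh2c.neg.div hhc hne))).add hWc).sub continuousOn_const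
  have hWlim : Tendsto W atTop (nhds 0) :=
    tendsto_const_nhds.div_atTop ((tendsto_pow_atTop two_ne_zero).comp hlim)
  have hA2 : Tendsto (fun r => r * (deriv h r / h r) ^ 2) atTop (nhds 0) := by
    refine squeeze_zero' (g := fun r => ε r ^ 2) ?_ ?_ (by simpa using hεlim.pow 2)
    · filter_upwards [eventually_ge_atTop 0] with r hr
      positivity
    · filter_upwards [eventually_gt_atTop r₀] with r hr
      have hr0 : 0 < r := hr₀.trans hr
      have h1 : (deriv h r / h r) ^ 2 ≤ (ε r / √r) ^ 2 :=
        pow_le_pow_left₀ (div_nonneg (hderiv_nonneg r hr) (hpos r hr).le) (HA r hr).2 2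
      rw [div_pow (ε r), Real.sq_sqrt hr0.le, le_div_iff₀ hr0] at h1
      linarith
  have hVlim : Tendsto (fun t => t * V t) atTop (nhds 0) := by
    have := (hA2.const_mul ((n - 1 : ℝ) * (n - 3 : ℝ) / 4)).sub (HK.const_mul ((n - 1 : ℝ) / 2))
    simp only [mul_zero, sub_zero] at this
    refine this.congr fun t => ?_
    simp only [hVdef]
    ring
  have hev : ∀ᶠ t in atTop, W t ≤ lam / 2 ∧ (t * V t) ^ 2 ≤ lam / 2 ∧ -1 ≤ V t ∧ r₀ < t := by
    have hVsq : Tendsto (fun t => (t * V t) ^ 2) atTop (nhds 0) := by simpa using hVlim.pow 2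
    filter_upwards [hWlim.eventually_le_const (half_pos hlam),
      hVsq.eventually_le_const (half_pos hlam),
      hVlim.eventually_const_le (by norm_num : (-1 : ℝ) < 0),
      eventually_gt_atTop r₀, eventually_ge_atTop 1] with t h1 h2 h3 h4 h5
    refine ⟨h1, h2, ?_, h4⟩
    by_contra! hlt
    nlinarith
  obtain ⟨X, hX⟩ := eventually_atTop.1 hev
  have hzero : ∀ Y, X ≤ Y → u Y = 0 ∧ deriv u Y = 0 := by
    intro Y hY
    have hmem : ∀ t ∈ Ici Y, t ∈ Ioi r₀ := fun t ht => (hX t (hY.trans ht)).2.2.2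
    refine cauchy_data_eq_zero_of_integrableOn_sq hlam (hr₀.trans (hmem Y (mem_Ici.2 le_rfl)))
      (fun t ht => hu1 t (hmem t ht)) (fun t ht => hu2' t (hmem t ht))
      (fun t ht => hWder t (hmem t ht)) (fun t ht => ?_) (fun t ht => ?_)
      (fun t ht => (hX t (hY.trans ht)).1) (fun t ht => (hX t (hY.trans ht)).2.1)
      (fun t ht => (hX t (hY.trans ht)).2.2.1)
      (hint.mono_set (Ioi_subset_Ioi (hmem Y (mem_Ici.2 le_rfl)).le))
    · have h1 := hderiv_nonneg t (hmem t ht)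
      have h2 := hpos t (hmem t ht)
      rw [neg_div]
      exact neg_nonpos.2 (by positivity)
    · exact div_nonneg hμ (sq_nonneg _)
  intro x hx
  have hsub : Icc x (max x X) ⊆ Ioi r₀ := fun t ht => lt_of_lt_of_le hx ht.1
  obtain ⟨h0, h0'⟩ := hzero (max x X) (le_max_right _ _)
  exact eq_zero_of_cauchy_data_eq_zero (le_max_left _ _) (fun t ht => hu1 t (hsub ht))
    (fun t ht => hu2' t (hsub ht)) (hQcont.mono hsub) h0 h0'
end

section
/- Let n ≥ 2 be an integer, r₀ > 0, and let h : [r₀,∞) → (0,∞) be a C² function. Set A_h(r) = h'(r)/h(r) and K_h(r) = −h''(r)/h(r). Let a > 0 be a constant and assume: A_h(r₀) ≥ a/r₀ if 0 < a < 1, and A_h(r₀) > 0 if a ≥ 1; and there is a function ε : (r₀,∞) → (0,∞) with lim_{t→∞} ε(t) = 0 such that −ε(r)/r ≤ K_h(r) ≤ a(1−a)/r² for all r > r₀. Then for every λ > 0, any C² function u : [r₀,∞) → ℝ satisfying u''(r) + (n−1)A_h(r)u'(r) + λu(r) = 0 on (r₀,∞) and ∫_{r₀}^∞ h(r)^{n−1}(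 u(r)² + u'(r)² ) dr < ∞ vanishes identically on [r₀,∞). -/
open Real Filter MeasureTheory Set

/-- A function with nonnegative derivative on a ray is bounded below by its initial value. -/
lemma le_of_hasDerivAt_nonneg_Ioi {f f' : ℝ → ℝ} {R : ℝ} (hc : ContinuousOn f (Ici R))
    (hf : ∀ x ∈ Ioi R, HasDerivAt f (f' x) x) (hf' : ∀ x ∈ Ioi R, 0 ≤ f' x)
    {r : ℝ} (hr : R ≤ r) : f R ≤ f r := by
  refine monotoneOn_of_deriv_nonneg (convex_Ici R) hc ?_ ?_ self_mem_Ici hr hr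
  · rw [interior_Ici]
    exact fun x hx => (hf x hx).differentiableAt.differentiableWithinAt
  · rw [interior_Ici]
    exact fun x hx => (hf x hx).deriv ▸ hf' x hx

/-- A function whose derivative is at least `-M` times its value gains at most the exponential
factor `exp (M * (y - x))` when moving backwards. -/
lemma mul_exp_le_mul_exp {f f' : ℝ → ℝ} {M x y : ℝ} (hxy : x ≤ y)
    (hf : ∀ r ∈ Icc x y, HasDerivAt f (f' r) r) (hf' : ∀ r ∈ Icc x y, 0 ≤ f' r + M * f r) :
    f x * exp (M * x) ≤ f y * exp (M * y) := by
  have hd : ∀ r ∈ Icc x y, HasDerivAt (fun r => f r * exp (M * r))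
      (f' r * exp (M * r) + f r * (exp (M * r) * (M * 1))) r := fun r hr =>
    (hf r hr).mul (((hasDerivAt_id r).const_mul M).exp)
  refine monotoneOn_of_deriv_nonneg (convex_Icc x y)
    (fun r hr => (hd r hr).continuousAt.continuousWithinAt) ?_ ?_
    (left_mem_Icc.2 hxy) (right_mem_Icc.2 hxy) hxy
  · exact fun r hr => (hd r (interior_subset hr)).differentiableAt.differentiableWithinAt
  · intro r hr
    rw [(hd r (interior_subset hr)).deriv]
    have := mul_nonneg (hf' r (interior_subset hr)) (exp_pos (M * r)).le
    linarith

/-- A `C²` function on a closed ray is twice differentiable on the open ray, with continuous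
second derivative. -/
lemma ContDiffOn.hasDerivAt_two_Ioi {f : ℝ → ℝ} {r₀ : ℝ} (hf : ContDiffOn ℝ 2 f (Ici r₀)) :
    (∀ r ∈ Ioi r₀, HasDerivAt f (deriv f r) r) ∧
    (∀ r ∈ Ioi r₀, HasDerivAt (deriv f) (deriv (deriv f) r) r) ∧
    ContinuousOn (deriv (deriv f)) (Ioi r₀) := by
  have h2 : ContDiffOn ℝ 2 f (Ioi r₀) := hf.mono Ioi_subset_Ici_self
  have h1 : ContDiffOn ℝ 1 (deriv f) (Ioi r₀) :=
    h2.deriv_of_isOpen isOpen_Ioi (by norm_num)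
  have h0 : ContDiffOn ℝ 0 (deriv (deriv f)) (Ioi r₀) :=
    h1.deriv_of_isOpen isOpen_Ioi (by norm_num)
  refine ⟨fun r hr => ?_, fun r hr => ?_, h0.continuousOn⟩
  · exact ((h2.differentiableOn (by norm_num)).differentiableAt (Ioi_mem_nhds hr)).hasDerivAt
  · exact ((h1.differentiableOn (by norm_num)).differentiableAt (Ioi_mem_nhds hr)).hasDerivAt

/-- If `f` is `C¹` on a closed ray and genuinely differentiable at its endpoint, then `deriv f` is
continuous up to the endpoint. -/
lemma ContDiffOn.continuousOn_deriv_Ici {f : ℝ → ℝ} {r₀ : ℝ} (hf : ContDiffOn ℝ 1 f (Ici r₀))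
    (h₀ : DifferentiableAt ℝ f r₀) : ContinuousOn (deriv f) (Ici r₀) := by
  refine (hf.continuousOn_derivWithin (uniqueDiffOn_Ici r₀) le_rfl).congr fun r hr => ?_
  have hd : DifferentiableAt ℝ f r := by
    rcases eq_or_lt_of_le (mem_Ici.1 hr) with rfl | hlt
    · exact h₀
    · exact ((hf.differentiableOn (by norm_num)) r hr).differentiableAt (Ici_mem_nhds hlt)
  exact (hd.derivWithin (uniqueDiffOn_Ici r₀ r hr)).symm

/-- Sturm-type comparison with `r ^ a`: a warping function whose radial curvature is at most
`a (1 - a) / r²` is increasing once its initial logarithmic derivative is large enough. -/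
lemma deriv_nonneg_of_curvature_le {r₀ a : ℝ} (hr₀ : 0 < r₀) (ha : 0 < a) {h : ℝ → ℝ}
    (hh : ContDiffOn ℝ 2 h (Ici r₀)) (hhpos : ∀ r ∈ Ici r₀, 0 < h r)
    (Hinit₁ : a < 1 → a / r₀ ≤ deriv h r₀ / h r₀)
    (Hinit₂ : 1 ≤ a → 0 < deriv h r₀ / h r₀)
    (HK : ∀ r ∈ Ioi r₀, -(deriv (deriv h) r) / h r ≤ a * (1 - a) / r ^ 2)
    {r : ℝ} (hr : r₀ ≤ r) : 0 ≤ deriv h r := by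
  obtain ⟨hd1, hd2, -⟩ := hh.hasDerivAt_two_Ioi
  have hp₀ := hhpos r₀ self_mem_Ici
  have hpos₀ : 0 < deriv h r₀ := by
    have : 0 < deriv h r₀ / h r₀ := by
      rcases lt_or_ge a 1 with h1 | h1
      · exact (div_pos ha hr₀).trans_le (Hinit₁ h1)
      · exact Hinit₂ h1
    exact (div_pos_iff_of_pos_right hp₀).1 this
  have hc1 : ContinuousOn (deriv h) (Ici r₀) :=
    (hh.of_le (by norm_num)).continuousOn_deriv_Ici
      (differentiableAt_of_deriv_ne_zero hpos₀.ne')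
  have hK : ∀ x ∈ Ioi r₀, 0 ≤ x ^ 2 * deriv (deriv h) x + a * (1 - a) * h x := by
    intro x hx
    have hx0 : 0 < x := hr₀.trans hx
    have := HK x hx
    rw [div_le_div_iff₀ (hhpos x (Ioi_subset_Ici_self hx)) (by positivity)] at this
    linarith
  rcases lt_or_ge a 1 with h1 | h1
  · have hd : ∀ x ∈ Ioi r₀, HasDerivAt (fun x => (x * deriv h x - a * h x) * x ^ (a - 1))
        ((1 * deriv h x + x * deriv (deriv h) x - a * deriv h x) * x ^ (a - 1)
          + (x * deriv h x - a * h x) * ((a - 1) * x ^ (a - 1 - 1))) x := fun x hx =>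
      (((hasDerivAt_id x).mul (hd2 x hx)).sub ((hd1 x hx).const_mul a)).mul
        (hasDerivAt_rpow_const (Or.inl (hr₀.trans hx).ne'))
    have hle := le_of_hasDerivAt_nonneg_Ioi (R := r₀) (r := r) ?_ hd ?_ hr
    · have hr0 : 0 < r := hr₀.trans_le hr
      have hinit : 0 ≤ r₀ * deriv h r₀ - a * h r₀ := by
        have := Hinit₁ h1
        rw [div_le_div_iff₀ hr₀ hp₀] at this
        linarith
      have h2 := (mul_nonneg hinit (rpow_nonneg hr₀.le (a - 1))).trans hle
      have h3 := nonneg_of_mul_nonneg_left h2 (rpow_pos_of_pos hr0 _)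
      have h4 := mul_pos ha (hhpos r hr)
      exact nonneg_of_mul_nonneg_right (by linarith : 0 ≤ r * deriv h r) hr0
    · refine ((continuousOn_id.mul hc1).sub (continuousOn_const.mul hh.continuousOn)).mul ?_
      exact continuousOn_id.rpow_const fun x hx => Or.inl (hr₀.trans_le hx).ne'
    · intro x hx
      have hx0 : 0 < x := hr₀.trans hx
      have e : x ^ (a - 1) = x * x ^ (a - 1 - 1) := by
        rw [rpow_sub_one hx0.ne' (a - 1)]
        field_simp
      rw [e]
      have := mul_nonneg (hK x hx) (rpow_nonneg hx0.le (a - 1 - 1))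
      linarith
  · refine hpos₀.le.trans (le_of_hasDerivAt_nonneg_Ioi hc1 hd2 (fun x hx => ?_) hr)
    have hx0 : 0 < x := hr₀.trans hx
    have h3 : a * (1 - a) * h x ≤ 0 := mul_nonpos_of_nonpos_of_nonneg
      (mul_nonpos_of_nonneg_of_nonpos ha.le (by linarith)) (hhpos x (Ioi_subset_Ici_self hx)).le
    have := hK x hx
    exact nonneg_of_mul_nonneg_right (by linarith : 0 ≤ x ^ 2 * deriv (deriv h) x) (by positivity)

/-- The energy of `h ^ (m / 2) * u`, where `u'' + m A u' + lam u = 0`, `A = h' / h`, and `H = h ^ m`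
is characterised by `H' = m A H`: its derivative only involves the potential
`m / 2 * A' + m ^ 2 / 4 * A ^ 2`. -/
lemma hasDerivAt_energy {H A u u₁ : ℝ → ℝ} {m lam A' u₂ r : ℝ}
    (hH : HasDerivAt H (m * A r * H r) r) (hA : HasDerivAt A A' r)
    (hu : HasDerivAt u (u₁ r) r) (hu₁ : HasDerivAt u₁ u₂ r)
    (hode : u₂ + m * A r * u₁ r + lam * u r = 0) :
    HasDerivAt (fun r => H r * ((u₁ r + m / 2 * A r * u r) ^ 2 + lam * u r ^ 2))
      (2 * H r * (m / 2 * A' + m ^ 2 / 4 * A r ^ 2) * (u₁ r + m / 2 * A r * u r) * u r) r := by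
  have := hH.mul (((hu₁.add ((hA.const_mul (m / 2)).mul hu)).pow 2).add
    ((hu.pow 2).const_mul lam))
  refine this.congr_deriv ?_
  obtain rfl : u₂ = -(m * A r * u₁ r) - lam * u r := by linarith
  simp only [Pi.add_apply, Pi.mul_apply, Pi.pow_apply]
  push_cast
  ring

lemma neg_abs_div_mul_energy_le {P V w v s : ℝ} (hP : 0 ≤ P) (hs : 0 < s) :
    -(|V| / s) * (P * (w ^ 2 + s ^ 2 * v ^ 2)) ≤ 2 * P * V * w * v := by
  have h1 : |2 * s * w * v| ≤ w ^ 2 + s ^ 2 * v ^ 2 :=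
    abs_le.2 ⟨by nlinarith [sq_nonneg (w + s * v)], by nlinarith [sq_nonneg (w - s * v)]⟩
  have h2 : -(|V| * (w ^ 2 + s ^ 2 * v ^ 2)) ≤ V * (2 * s * w * v) := by
    have := neg_abs_le (V * (2 * s * w * v))
    rw [abs_mul] at this
    have := mul_le_mul_of_nonneg_left h1 (abs_nonneg V)
    linarith
  have h3 := mul_le_mul_of_nonneg_left h2 (div_nonneg hP hs.le)
  calc _ = P / s * -(|V| * (w ^ 2 + s ^ 2 * v ^ 2)) := by ring
    _ ≤ _ := h3
    _ = _ := by field_simp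

/-- The energy is controlled by the `H¹` density, up to an exponential in the mean curvature. -/
lemma energy_mul_exp_neg_le {P A m lam c v w : ℝ} (hP : 0 ≤ P) (hA : 0 ≤ A) (hlam : 0 < lam)
    (hc : 1 ≤ c) :
    P * ((w + m / 2 * A * v) ^ 2 + lam * v ^ 2) * exp (-(c * A))
      ≤ 2 * (2 + m ^ 2 + lam) * (P * (v ^ 2 + w ^ 2)) := by
  have h1 : (w + m / 2 * A * v) ^ 2 + lam * v ^ 2
      ≤ (2 + m ^ 2 + lam) * (v ^ 2 + w ^ 2) * (1 + A ^ 2) := by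
    have e1 : (w + m / 2 * A * v) ^ 2 ≤ 2 * w ^ 2 + m ^ 2 * A ^ 2 * v ^ 2 := by
      nlinarith [sq_nonneg (w - m / 2 * A * v), sq_nonneg (m * A * v)]
    have e2 : (2 + m ^ 2 + lam) * (v ^ 2 + w ^ 2) * (1 + A ^ 2)
        = 2 * w ^ 2 + m ^ 2 * A ^ 2 * v ^ 2 + lam * v ^ 2 + (2 * v ^ 2 + m ^ 2 * v ^ 2
          + m ^ 2 * w ^ 2 + lam * w ^ 2 + 2 * A ^ 2 * v ^ 2 + 2 * A ^ 2 * w ^ 2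
          + m ^ 2 * A ^ 2 * w ^ 2 + lam * A ^ 2 * v ^ 2 + lam * A ^ 2 * w ^ 2) := by ring
    rw [e2]
    have : 0 ≤ 2 * v ^ 2 + m ^ 2 * v ^ 2
          + m ^ 2 * w ^ 2 + lam * w ^ 2 + 2 * A ^ 2 * v ^ 2 + 2 * A ^ 2 * w ^ 2
          + m ^ 2 * A ^ 2 * w ^ 2 + lam * A ^ 2 * v ^ 2 + lam * A ^ 2 * w ^ 2 := by positivity
    linarith
  have h2 : (1 + A ^ 2) * exp (-(c * A)) ≤ 2 := by
    have e1 := quadratic_le_exp_of_nonneg hA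
    have e2 : exp A ≤ exp (c * A) := exp_le_exp.2 (le_mul_of_one_le_left hA hc)
    rw [exp_neg, ← div_eq_mul_inv, div_le_iff₀ (exp_pos _)]
    linarith
  calc _ ≤ P * ((2 + m ^ 2 + lam) * (v ^ 2 + w ^ 2) * (1 + A ^ 2)) * exp (-(c * A)) := by gcongr
    _ = (2 + m ^ 2 + lam) * (P * (v ^ 2 + w ^ 2)) * ((1 + A ^ 2) * exp (-(c * A))) := by ring
    _ ≤ (2 + m ^ 2 + lam) * (P * (v ^ 2 + w ^ 2)) * 2 := by gcongr
    _ = _ := by ring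

/-- Bound of the effective potential in terms of curvature bounds and of the derivative of the
mean curvature, where `-(A' + A ^ 2)` is the radial curvature. -/
lemma abs_potential_div_le {m s A A' e k r : ℝ} (hm : 1 ≤ m) (hs : 0 < s) (hr : 0 < r)
    (he : 0 ≤ e) (hlow : A' + A ^ 2 ≤ e / r) (hup : -(A' + A ^ 2) ≤ k / r ^ 2) (hk : 0 ≤ k)
    (hsmall : ((m / 2 + m ^ 2) / s + 1) * e + m / 2 * k / s * r⁻¹ ≤ 1) :
    |m / 2 * A' + m ^ 2 / 4 * A ^ 2| / s ≤ 1 / r - (m ^ 2 / s + 1) * A' := by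
  have he' : 0 ≤ e / r := by positivity
  have hk' : 0 ≤ k / r ^ 2 := by positivity
  have h1 : |A' + A ^ 2| ≤ e / r + k / r ^ 2 := abs_le.2 ⟨by linarith, by linarith⟩
  have h2 : |m ^ 2 / 4 - m / 2| ≤ m ^ 2 := abs_le.2 ⟨by nlinarith, by nlinarith⟩
  have h3 : |m / 2 * A' + m ^ 2 / 4 * A ^ 2| ≤
      m / 2 * (e / r + k / r ^ 2) + m ^ 2 * (e / r - A') := by
    calc _ = |m / 2 * (A' + A ^ 2) + (m ^ 2 / 4 - m / 2) * A ^ 2| := by ring_nf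
      _ ≤ m / 2 * |A' + A ^ 2| + |m ^ 2 / 4 - m / 2| * A ^ 2 := by
        refine (abs_add_le _ _).trans_eq ?_
        rw [abs_mul, abs_mul, abs_of_nonneg (sq_nonneg A), abs_of_pos (by linarith : 0 < m / 2)]
      _ ≤ m / 2 * (e / r + k / r ^ 2) + m ^ 2 * A ^ 2 := by gcongr
      _ ≤ _ := by
        gcongr
        linarith
  have h4 : 0 ≤ e / r - A' := by nlinarith [sq_nonneg A]
  have h5 := mul_le_mul_of_nonneg_right hsmall (inv_nonneg.2 hr.le)
  calc _ ≤ (m / 2 * (e / r + k / r ^ 2) + m ^ 2 * (e / r - A')) / s := by gcongr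
    _ ≤ (m / 2 * (e / r + k / r ^ 2) + m ^ 2 * (e / r - A')) / s + (e / r - A') := by linarith
    _ = (((m / 2 + m ^ 2) / s + 1) * e + m / 2 * k / s * r⁻¹) * r⁻¹
        - (m ^ 2 / s + 1) * A' := by
      field_simp
      ring
    _ ≤ _ := by
      rw [one_div]
      linarith

/-- Theorem 1.4 of the paper, radial (rotationally symmetric) form. -/
theorem stmt_3
    (n : ℕ) (hn : 2 ≤ n)
    (r₀ a : ℝ) (hr₀ : 0 < r₀) (ha : 0 < a)
    (h : ℝ → ℝ) (hh : ContDiffOn ℝ 2 h (Ici r₀))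
    (hhpos : ∀ r ∈ Ici r₀, 0 < h r)
    (Hinit₁ : a < 1 → a / r₀ ≤ deriv h r₀ / h r₀)
    (Hinit₂ : 1 ≤ a → 0 < deriv h r₀ / h r₀)
    (ε : ℝ → ℝ) (hεpos : ∀ t ∈ Ioi r₀, 0 < ε t)
    (hεlim : Filter.Tendsto ε Filter.atTop (nhds 0))
    (HK : ∀ r ∈ Ioi r₀,
      -(ε r) / r ≤ -(deriv (deriv h) r) / h r ∧
      -(deriv (deriv h) r) / h r ≤ a * (1 - a) / r ^ 2) :
    ∀ lam : ℝ, 0 < lam → ∀ u : ℝ → ℝ,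
      ContDiffOn ℝ 2 u (Ici r₀) →
      (∀ r ∈ Ioi r₀,
        deriv (deriv u) r + (n - 1 : ℝ) * (deriv h r / h r) * deriv u r + lam * u r = 0) →
      MeasureTheory.IntegrableOn
        (fun r => h r ^ (n - 1) * (u r ^ 2 + deriv u r ^ 2)) (Ioi r₀) →
      ∀ r ∈ Ici r₀, u r = 0 := by
  intro lam hlam u hu hode hint
  suffices hmain : ∀ r ∈ Ioi r₀, u r = 0 by
    exact EqOn.of_subset_closure (g := fun _ => 0) hmain hu.continuousOn continuousOn_const
      Ioi_subset_Ici_self (closure_Ioi r₀).ge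
  intro r₁ hr₁
  by_contra hne
  obtain ⟨hh1, hh2, hhc⟩ := hh.hasDerivAt_two_Ioi
  obtain ⟨hu1, hu2, -⟩ := hu.hasDerivAt_two_Ioi
  have hpos : ∀ r ∈ Ioi r₀, 0 < h r := fun r hr => hhpos r (Ioi_subset_Ici_self hr)
  set m : ℝ := (n : ℝ) - 1 with hm_def
  have hm : 1 ≤ m := by
    have : (2 : ℝ) ≤ n := by exact_mod_cast hn
    linarith
  set s := √lam with hs_def
  have hs : 0 < s := sqrt_pos.2 hlam
  have hs2 : s ^ 2 = lam := sq_sqrt hlam.le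
  set A : ℝ → ℝ := fun r => deriv h r / h r with hA_def
  set A' : ℝ → ℝ := fun r => deriv (deriv h) r / h r - A r ^ 2 with hA'_def
  have hAnonneg : ∀ r ∈ Ioi r₀, 0 ≤ A r := fun r hr =>
    div_nonneg (deriv_nonneg_of_curvature_le hr₀ ha hh hhpos Hinit₁ Hinit₂
      (fun r hr => (HK r hr).2) (le_of_lt hr)) (hpos r hr).le
  have hA : ∀ r ∈ Ioi r₀, HasDerivAt A (A' r) r := fun r hr => by
    refine ((hh2 r hr).div (hh1 r hr) (hpos r hr).ne').congr_deriv ?_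
    have := (hpos r hr).ne'
    simp only [hA'_def, hA_def]
    field_simp
  have hH : ∀ r ∈ Ioi r₀, HasDerivAt (fun r => h r ^ (n - 1)) (m * A r * h r ^ (n - 1)) r :=
    fun r hr => by
      refine ((hh1 r hr).pow (n - 1)).congr_deriv ?_
      have := (hpos r hr).ne'
      obtain ⟨k, rfl⟩ := Nat.exists_eq_add_of_le' hn
      simp only [hA_def, hm_def, Nat.add_sub_cancel, show k + 2 - 1 = k + 1 by omega]
      push_cast
      field_simp
      ring
  set V : ℝ → ℝ := fun r => m / 2 * A' r + m ^ 2 / 4 * A r ^ 2 with hV_def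
  have hVc : ContinuousOn V (Ioi r₀) := by
    have hAc : ContinuousOn A (Ioi r₀) := fun r hr => (hA r hr).continuousAt.continuousWithinAt
    have hhc0 : ContinuousOn h (Ioi r₀) := hh.continuousOn.mono Ioi_subset_Ici_self
    exact (continuousOn_const.mul ((hhc.div hhc0 fun r hr => (hpos r hr).ne').sub
      (hAc.pow 2))).add (continuousOn_const.mul (hAc.pow 2))
  set E : ℝ → ℝ := fun r =>
    h r ^ (n - 1) * ((deriv u r + m / 2 * A r * u r) ^ 2 + lam * u r ^ 2) with hE_def
  set E' : ℝ → ℝ := fun r =>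
    2 * h r ^ (n - 1) * V r * (deriv u r + m / 2 * A r * u r) * u r with hE'_def
  have hEd : ∀ r ∈ Ioi r₀, HasDerivAt E (E' r) r := fun r hr =>
    hasDerivAt_energy (hH r hr) (hA r hr) (hu1 r hr) (hu2 r hr) (hode r hr)
  have hElow : ∀ r ∈ Ioi r₀, -(|V r| / s) * E r ≤ E' r := fun r hr => by
    have := neg_abs_div_mul_energy_le (V := V r) (w := deriv u r + m / 2 * A r * u r) (v := u r)
      (pow_pos (hpos r hr) (n - 1)).le hs
    rwa [hs2] at this
  have hEnonneg : ∀ r ∈ Ioi r₀, 0 ≤ E r := fun r hr => by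
    have := hpos r hr
    positivity
  have hE1 : 0 < E r₁ := by
    have := hpos r₁ hr₁
    positivity
  set κ := |a * (1 - a)| with hκ
  obtain ⟨R, hRr₁, hR⟩ : ∃ R, r₁ ≤ R ∧ ∀ r ≥ R,
      ((m / 2 + m ^ 2) / s + 1) * ε r + m / 2 * κ / s * r⁻¹ ≤ 1 := by
    have hlim : Tendsto (fun r => ((m / 2 + m ^ 2) / s + 1) * ε r + m / 2 * κ / s * r⁻¹)
        atTop (nhds (((m / 2 + m ^ 2) / s + 1) * 0 + m / 2 * κ / s * 0)) :=
      (hεlim.const_mul _).add (tendsto_inv_atTop_zero.const_mul _)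
    have hev := hlim.eventually_le_const (by simp : _ < (1 : ℝ))
    obtain ⟨R, hR⟩ := eventually_atTop.1 hev
    exact ⟨max r₁ R, le_max_left _ _, fun r hr => hR r ((le_max_right _ _).trans hr)⟩
  have hRr₀ : r₀ < R := lt_of_lt_of_le hr₁ hRr₁
  have hER : 0 < E R := by
    have hsub : Icc r₁ R ⊆ Ioi r₀ := fun r hr => lt_of_lt_of_le hr₁ hr.1
    obtain ⟨C, hC⟩ := isCompact_Icc.exists_bound_of_continuousOn (hVc.mono hsub)
    have := mul_exp_le_mul_exp (M := C / s) hRr₁ (fun r hr => hEd r (hsub hr)) fun r hr => by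
      have h1 := hElow r (hsub hr)
      have h2 : |V r| / s * E r ≤ C / s * E r := by
        have := hEnonneg r (hsub hr)
        have := hC r hr
        rw [norm_eq_abs] at this
        gcongr
      linarith
    exact pos_of_mul_pos_left ((mul_pos hE1 (exp_pos _)).trans_le this) (exp_pos _).le
  set c := m ^ 2 / s + 1 with hc_def
  have hc : 1 ≤ c := le_add_of_nonneg_left (by positivity)
  have hGd : ∀ r ∈ Ioi r₀, HasDerivAt (fun r => E r * exp (-(c * A r)) * r)
      ((E' r * exp (-(c * A r)) + E r * (exp (-(c * A r)) * -(c * A' r))) * r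
        + E r * exp (-(c * A r)) * 1) r := fun r hr =>
    ((hEd r hr).mul (((hA r hr).const_mul c).neg.exp)).mul (hasDerivAt_id r)
  have hG : ∀ r ∈ Ioi R, E R * exp (-(c * A R)) * R ≤ E r * exp (-(c * A r)) * r := by
    intro r hr
    refine le_of_hasDerivAt_nonneg_Ioi
      (fun x hx => (hGd x (hRr₀.trans_le hx)).continuousAt.continuousWithinAt)
      (fun x hx => hGd x (hRr₀.trans hx)) (fun x hx => ?_) (le_of_lt hr)
    have hx₀ : x ∈ Ioi r₀ := hRr₀.trans hx
    have hx0 : 0 < x := hr₀.trans hx₀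
    have hV : |V x| / s ≤ 1 / x - c * A' x := by
      obtain ⟨hK1, hK2⟩ := HK x hx₀
      have hA'x : A' x + A x ^ 2 = deriv (deriv h) x / h x := by simp [hA'_def]
      refine abs_potential_div_le hm hs hx0 (hεpos x hx₀).le ?_ ?_ (abs_nonneg _)
        (hR x (le_of_lt hx))
      · rw [hA'x]
        rw [neg_div, neg_div] at hK1
        linarith
      · rw [hA'x, ← neg_div]
        refine hK2.trans ?_
        gcongr
        exact le_abs_self _
    have h1 : 0 ≤ E' x * x - E x * (c * A' x) * x + E x := by
      have h2 := mul_le_mul_of_nonneg_right (hElow x hx₀) hx0.le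
      have h3 := mul_le_mul_of_nonneg_right hV (mul_nonneg (hEnonneg x hx₀) hx0.le)
      have h4 : (1 / x - c * A' x) * (E x * x) = E x - E x * (c * A' x) * x := by
        field_simp
      linarith
    have := mul_nonneg h1 (exp_pos (-(c * A x))).le
    linarith
  set g := E R * exp (-(c * A R)) * R with hg_def
  have hg : 0 < g := mul_pos (mul_pos hER (exp_pos _)) (hr₀.trans hRr₀)
  set D := 2 * (2 + m ^ 2 + lam) with hD_def
  have hD : 0 < D := by positivity
  have hinv : IntegrableOn (fun r : ℝ => r⁻¹) (Ioi R) := by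
    refine Integrable.mono' ((hint.mono_set (Ioi_subset_Ioi hRr₀.le)).const_mul (D / g))
      measurable_inv.aestronglyMeasurable ?_
    filter_upwards [ae_restrict_mem measurableSet_Ioi] with r hr
    have hr' : r ∈ Ioi r₀ := hRr₀.trans hr
    have hr0 : 0 < r := hr₀.trans hr'
    have hb : E r * exp (-(c * A r)) ≤ D * (h r ^ (n - 1) * (u r ^ 2 + deriv u r ^ 2)) :=
      energy_mul_exp_neg_le (pow_pos (hpos r hr') _).le (hAnonneg r hr') hlam hc
    rw [norm_eq_abs, abs_of_pos (inv_pos.2 hr0), div_mul_eq_mul_div, le_div_iff₀ hg,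
      inv_mul_le_iff₀ hr0, mul_comm r]
    exact (hG r hr).trans (mul_le_mul_of_nonneg_right hb hr0.le)
  exact not_integrableOn_Ioi_inv hinv
end

section
/- Let x₀ > 0 and let V₁, V₂ : (x₀,∞) → ℝ be bounded functions, with V₁ continuous and V₂ of class C¹. Assume lim_{x→∞} x·V₁(x) = 0, lim_{x→∞} V₂(x) = 0, and lim_{x→∞} x·V₂'(x) = 0. Then for every λ > 0, any C² function u : (x₀,∞) → ℝ satisfying −u''(x) + (V₁(x) + V₂(x))u(x) = λ u(x) on (x₀,∞) and ∫_{x₀}^∞ u(x)² dx < ∞ vanishes identically on (x₀,∞). -/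
open Real Filter MeasureTheory Set

lemma monotoneOn_Ioi_of_hasDerivAt_nonneg {f f' : ℝ → ℝ} {a : ℝ}
    (hf : ∀ x ∈ Ioi a, HasDerivAt f (f' x) x) (hf' : ∀ x ∈ Ioi a, 0 ≤ f' x) :
    MonotoneOn f (Ioi a) := by
  apply monotoneOn_of_deriv_nonneg (convex_Ioi a)
  · exact fun x hx => (hf x hx).continuousAt.continuousWithinAt
  · rw [interior_Ioi]
    exact fun x hx => (hf x hx).differentiableAt.differentiableWithinAt
  · rw [interior_Ioi]
    intro x hx
    rw [(hf x hx).deriv]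
    exact hf' x hx

/-- Backward uniqueness for `u'' = q u` with a bounded coefficient `q`. -/
lemma eq_zero_of_cauchy_data_eq_zero_s5 {u v q : ℝ → ℝ} {a b C x : ℝ}
    (hu : ∀ x ∈ Ioi a, HasDerivAt u (v x) x) (hv : ∀ x ∈ Ioi a, HasDerivAt v (q x * u x) x)
    (hq : ∀ x ∈ Ioi a, |q x| ≤ C) (hub : u b = 0) (hvb : v b = 0) (hx : x ∈ Ioi a)
    (hxb : x ≤ b) : u x = 0 := by
  have hmono : MonotoneOn (fun x => exp ((1 + C) * x) * (u x ^ 2 + v x ^ 2)) (Ioi a) := by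
    refine monotoneOn_Ioi_of_hasDerivAt_nonneg
      (f' := fun x => exp ((1 + C) * x) *
        ((1 + C) * (u x ^ 2 + v x ^ 2) + (2 * u x * v x + 2 * v x * (q x * u x)))) ?_ ?_
    · intro y hy
      have h1 : HasDerivAt (fun x => exp ((1 + C) * x)) (exp ((1 + C) * y) * (1 + C)) y := by
        simpa using ((hasDerivAt_id y).const_mul (1 + C)).exp
      refine (h1.mul (((hu y hy).pow 2).add ((hv y hy).pow 2))).congr_deriv ?_
      simp
      ring
    · intro y hy
      apply mul_nonneg (exp_pos _).le
      obtain ⟨h1, h2⟩ := abs_le.mp (hq y hy)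
      nlinarith [sq_nonneg (u y + v y), mul_nonneg (by linarith : 0 ≤ C + q y)
        (sq_nonneg (u y + v y)), mul_nonneg (by linarith : 0 ≤ C - q y) (sq_nonneg (u y - v y))]
  have h := hmono hx (lt_of_lt_of_le hx hxb) hxb
  simp only [hub, hvb] at h
  have h2 : u x ^ 2 + v x ^ 2 ≤ 0 := by
    by_contra! hc
    have := mul_pos (exp_pos ((1 + C) * x)) hc
    norm_num at h
    linarith
  nlinarith [sq_nonneg (u x), sq_nonneg (v x)]

/-- If `(u u')' ≥ c / x - M u²` near infinity with `c > 0`, then `u` is not square integrable. -/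
lemma not_integrableOn_sq_of_le_deriv {u v w : ℝ → ℝ} {a c M : ℝ} (ha : 0 < a) (hc : 0 < c)
    (hM : 0 ≤ M) (hu : ∀ x ∈ Ioi a, HasDerivAt u (v x) x)
    (hw : ∀ x ∈ Ioi a, HasDerivAt (fun x => u x * v x) (w x) x)
    (hle : ∀ x ∈ Ioi a, c / x - M * u x ^ 2 ≤ w x) :
    ¬ IntegrableOn (fun x => u x ^ 2) (Ioi a) := by
  intro hint
  have hcont : ContinuousOn (fun x => u x ^ 2) (Ioi a) := fun x hx =>
    ((hu x hx).continuousAt.pow 2).continuousWithinAt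
  have ha1 : a + 1 ∈ Ioi a := by simp
  set I : ℝ → ℝ := fun x => ∫ t in (a + 1)..x, u t ^ 2 with hI
  have hId : ∀ x ∈ Ioi a, HasDerivAt I (u x ^ 2) x := by
    intro x hx
    have hsub : uIcc (a + 1) x ⊆ Ioi a := ordConnected_Ioi.uIcc_subset ha1 hx
    exact intervalIntegral.integral_hasDerivAt_right
      (hcont.mono hsub).intervalIntegrable
      (hcont.stronglyMeasurableAtFilter isOpen_Ioi x hx)
      (hcont.continuousAt (isOpen_Ioi.mem_nhds hx))
  set B := ∫ t in Ioi a, u t ^ 2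
  have hIB : ∀ x, a + 1 ≤ x → I x ≤ B := by
    intro x hx
    simp only [hI]
    rw [intervalIntegral.integral_of_le hx]
    apply setIntegral_mono_set hint (Eventually.of_forall fun x => sq_nonneg _)
    exact (Ioc_subset_Ioi_self.trans (Ioi_subset_Ioi (by linarith))).eventuallyLE
  have hmono : MonotoneOn (fun x => u x * v x - c * log x + M * I x) (Ioi a) := by
    refine monotoneOn_Ioi_of_hasDerivAt_nonneg
      (f' := fun x => w x - c * x⁻¹ + M * u x ^ 2) ?_ ?_
    · intro x hx
      have hx0 : x ≠ 0 := (ha.trans hx).ne'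
      exact ((hw x hx).sub ((hasDerivAt_log hx0).const_mul c)).add ((hId x hx).const_mul M)
    · intro x hx
      have := hle x hx
      rw [div_eq_mul_inv] at this
      linarith
  set K := u (a + 1) * v (a + 1) - c * log (a + 1) + M * I (a + 1)
  obtain ⟨d, hd⟩ := eventually_atTop.mp
    (tendsto_log_atTop.eventually_ge_atTop ((1 - K + M * B) / c))
  set d' := max d (a + 1)
  have had : a + 1 ≤ d' := le_max_right _ _
  have huv : ∀ x ∈ Ioi d', 1 ≤ u x * v x := by
    intro x hx
    have hx' : d' < x := hx
    have hdx : d ≤ x := (le_max_left _ _).trans hx'.le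
    have h1 := hd x hdx
    rw [div_le_iff₀ hc] at h1
    have h2 : K ≤ u x * v x - c * log x + M * I x :=
      hmono ha1 (show a < x by linarith) (by linarith)
    have h3 := mul_le_mul_of_nonneg_left (hIB x (by linarith)) hM
    linarith
  have hsq : MonotoneOn (fun x => u x ^ 2 - x) (Ioi d') := by
    refine monotoneOn_Ioi_of_hasDerivAt_nonneg (f' := fun x => 2 * u x * v x - 1) ?_ ?_
    · intro x hx
      have hx' : d' < x := hx
      exact (((hu x (show a < x by linarith)).pow 2).sub (hasDerivAt_id x)).congr_deriv (by simp)
    · intro x hx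
      linarith [huv x hx]
  have hJ : MonotoneOn (fun x => I x - x) (Ioi (d' + 2)) := by
    refine monotoneOn_Ioi_of_hasDerivAt_nonneg (f' := fun x => u x ^ 2 - 1) ?_ ?_
    · intro x hx
      have hx' : d' + 2 < x := hx
      exact (hId x (show a < x by linarith)).sub (hasDerivAt_id x)
    · intro x hx
      have hx' : d' + 2 < x := hx
      have : u (d' + 1) ^ 2 - (d' + 1) ≤ u x ^ 2 - x :=
        hsq (show d' < d' + 1 by linarith) (show d' < x by linarith) (by linarith)
      linarith [sq_nonneg (u (d' + 1))]
  set e := d' + 3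
  set T := |B - I e| + 1
  have hT : 0 < T := by positivity
  have h1 : I e - e ≤ I (e + T) - (e + T) :=
    hJ (show d' + 2 < d' + 3 by linarith) (show d' + 2 < d' + 3 + T by linarith) (by linarith)
  have h2 := hIB (e + T) (show a + 1 ≤ d' + 3 + T by linarith)
  linarith [le_abs_self (B - I e)]

/-- One-dimensional form of Agmon's theorem (Lemma 2.1 of the paper). -/
theorem stmt_5
    (x₀ : ℝ) (hx₀ : 0 < x₀)
    (V₁ V₂ : ℝ → ℝ)
    (hV₁cont : ContinuousOn V₁ (Ioi x₀)) (hV₂C1 : ContDiffOn ℝ 1 V₂ (Ioi x₀))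
    (hV₁bd : ∃ C : ℝ, ∀ x ∈ Ioi x₀, |V₁ x| ≤ C)
    (hV₂bd : ∃ C : ℝ, ∀ x ∈ Ioi x₀, |V₂ x| ≤ C)
    (hV₁lim : Filter.Tendsto (fun x => x * V₁ x) Filter.atTop (nhds 0))
    (hV₂lim : Filter.Tendsto V₂ Filter.atTop (nhds 0))
    (hV₂'lim : Filter.Tendsto (fun x => x * deriv V₂ x) Filter.atTop (nhds 0)) :
    ∀ lam : ℝ, 0 < lam → ∀ u : ℝ → ℝ,
      ContDiffOn ℝ 2 u (Ioi x₀) →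
      (∀ x ∈ Ioi x₀, -(deriv (deriv u) x) + (V₁ x + V₂ x) * u x = lam * u x) →
      MeasureTheory.IntegrableOn (fun x => u x ^ 2) (Ioi x₀) →
      ∀ x ∈ Ioi x₀, u x = 0 := by
  intro lam hlam u hu2 hode hint x hx
  obtain ⟨C₁, hC₁⟩ := hV₁bd
  obtain ⟨C₂, hC₂⟩ := hV₂bd
  have hC₁0 : 0 ≤ C₁ := (abs_nonneg _).trans (hC₁ x hx)
  have hC₂0 : 0 ≤ C₂ := (abs_nonneg _).trans (hC₂ x hx)
  have hu : ∀ y ∈ Ioi x₀, HasDerivAt u (deriv u y) y := fun y hy =>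
    ((hu2.differentiableOn two_ne_zero).differentiableAt (isOpen_Ioi.mem_nhds hy)).hasDerivAt
  have hu1 : ContDiffOn ℝ 1 (deriv u) (Ioi x₀) := hu2.deriv_of_isOpen isOpen_Ioi (by norm_num)
  have hv : ∀ y ∈ Ioi x₀, HasDerivAt (deriv u) ((V₁ y + V₂ y - lam) * u y) y := by
    intro y hy
    have h := ((hu1.differentiableOn one_ne_zero).differentiableAt
      (isOpen_Ioi.mem_nhds hy)).hasDerivAt
    refine h.congr_deriv ?_
    linarith [hode y hy]
  have hV₂ : ∀ y ∈ Ioi x₀, HasDerivAt V₂ (deriv V₂ y) y := fun y hy =>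
    ((hV₂C1.differentiableOn one_ne_zero).differentiableAt (isOpen_Ioi.mem_nhds hy)).hasDerivAt
  set v := deriv u
  set δ := min 1 (lam / 4)
  have hδ : 0 < δ := by positivity
  have hδ1 : δ ≤ 1 := min_le_left _ _
  have hδ2 : δ ≤ lam / 4 := min_le_right _ _
  have hsmall : ∀ᶠ y in atTop, |y * V₁ y| ≤ δ ∧ V₂ y ≤ lam / 2 ∧ |y * deriv V₂ y| ≤ δ := by
    have h1 := hV₁lim.abs
    have h3 := hV₂'lim.abs
    rw [abs_zero] at h1 h3
    exact (h1.eventually_le_const hδ).and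
      ((hV₂lim.eventually_le_const (half_pos hlam)).and (h3.eventually_le_const hδ))
  obtain ⟨a', ha'⟩ := eventually_atTop.mp hsmall
  set a := max a' x
  have hax : x ≤ a := le_max_right _ _
  have hax₀ : x₀ < a := lt_of_lt_of_le hx hax
  have hsub : Ioi a ⊆ Ioi x₀ := Ioi_subset_Ioi hax₀.le
  have hsmall' : ∀ y ∈ Ioi a, |y * V₁ y| ≤ δ ∧ V₂ y ≤ lam / 2 ∧ |y * deriv V₂ y| ≤ δ :=
    fun y hy => ha' y ((le_max_left _ _).trans (le_of_lt hy))
  set E : ℝ → ℝ := fun y => v y ^ 2 + (lam - V₂ y) * u y ^ 2 with hE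
  have hEmono : MonotoneOn (fun y => y * E y) (Ioi a) := by
    refine monotoneOn_Ioi_of_hasDerivAt_nonneg
      (f' := fun y => E y + y * (2 * V₁ y * u y * v y - deriv V₂ y * u y ^ 2)) ?_ ?_
    · intro y hy
      have hy' := hsub hy
      refine ((hasDerivAt_id y).mul (((hv y hy').pow 2).add
        (((hV₂ y hy').const_sub lam).mul ((hu y hy').pow 2)))).congr_deriv ?_
      simp only [hE, Pi.add_apply, Pi.mul_apply, Pi.pow_apply, id_eq]
      push_cast
      ring
    · intro y hy
      obtain ⟨h1, h2, h3⟩ := hsmall' y hy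
      obtain ⟨h1a, h1b⟩ := abs_le.mp h1
      obtain ⟨h3a, h3b⟩ := abs_le.mp h3
      simp only [hE]
      nlinarith [mul_nonneg (by linarith : 0 ≤ δ + y * V₁ y) (sq_nonneg (u y + v y)),
        mul_nonneg (by linarith : 0 ≤ δ - y * V₁ y) (sq_nonneg (u y - v y)),
        mul_nonneg (by linarith : 0 ≤ δ - y * deriv V₂ y) (sq_nonneg (u y)),
        mul_nonneg (by linarith : 0 ≤ lam / 2 - V₂ y) (sq_nonneg (u y)),
        mul_nonneg (by linarith : 0 ≤ 1 - δ) (sq_nonneg (v y)),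
        mul_nonneg (by linarith : 0 ≤ lam / 4 - δ) (sq_nonneg (u y))]
  set b := a + 1
  have hba : b ∈ Ioi a := by simp [b]
  have hb0 : 0 < b := by linarith [show b = a + 1 from rfl]
  have hVb : 0 < lam - V₂ b := by linarith [(hsmall' b hba).2.1]
  have hEb : E b ≤ 0 := by
    by_contra! hEb
    have hsubb : Ioi b ⊆ Ioi a := Ioi_subset_Ioi (le_of_lt hba)
    refine not_integrableOn_sq_of_le_deriv (u := u) (v := v)
      (w := fun y => v y * v y + u y * ((V₁ y + V₂ y - lam) * u y))
      (c := b * E b) (M := 2 * lam + 2 * C₂ + C₁) hb0 (by positivity) (by positivity)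
      (fun y hy => hu y (hsub (hsubb hy)))
      (fun y hy => (hu y (hsub (hsubb hy))).mul (hv y (hsub (hsubb hy)))) ?_
      (hint.mono_set (hsubb.trans hsub))
    intro y hy
    have hy0 : 0 < y := hb0.trans hy
    have h1 : b * E b ≤ y * E y := hEmono hba (hsubb hy) (le_of_lt hy)
    have h2 : b * E b / y ≤ E y := by
      rw [div_le_iff₀ hy0]
      linarith
    have h3 := (abs_le.mp (hC₁ y (hsub (hsubb hy)))).1
    have h4 := (abs_le.mp (hC₂ y (hsub (hsubb hy)))).1
    simp only [hE] at h2 ⊢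
    nlinarith [mul_nonneg (by linarith : 0 ≤ C₁ + V₁ y + 2 * (C₂ + V₂ y)) (sq_nonneg (u y))]
  have hub2 : u b ^ 2 = 0 := by
    simp only [hE] at hEb
    nlinarith [sq_nonneg (u b), sq_nonneg (v b), mul_nonneg hVb.le (sq_nonneg (u b))]
  have hvb2 : v b ^ 2 = 0 := by
    simp only [hE, hub2] at hEb
    nlinarith [sq_nonneg (v b)]
  refine eq_zero_of_cauchy_data_eq_zero_s5 (C := C₁ + C₂ + lam) hu hv ?_
    (pow_eq_zero_iff two_ne_zero |>.mp hub2) (pow_eq_zero_iff two_ne_zero |>.mp hvb2) hx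
    (hax.trans (le_of_lt hba))
  intro y hy
  have h1 := abs_le.mp (hC₁ y hy)
  have h2 := abs_le.mp (hC₂ y hy)
  exact abs_le.mpr ⟨by linarith [h1.1, h2.1], by linarith [h1.2, h2.2]⟩
end

section
/- Let r₀ > 0 and a > 0 be constants, and let A : [r₀,∞) → ℝ be a C¹ function satisfying the Riccati equation A'(r) + A(r)² = −K(r) on [r₀,∞), where K : [r₀,∞) → ℝ is continuous and satisfies −ε(r)/r ≤ K(r) ≤ a(1−a)/r² for all r ≥ r₀, with ε : (r₀,∞) → (0,∞) a function such that lim_{t→∞} ε(t) = 0. Assume A(r₀) ≥ a/r₀ if 0 < a < 1, and A(r₀) > 0 if a ≥ 1. Then there exist a constant C ≥ 0 and a function ε₁ : (r₀,∞) → (0,∞) with lim_{t→∞} ε₁(t) = 0 such that a/r − C/r² ≤ A(r) ≤ ε₁(r)/√r for all r > r₀. -/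
open Real Filter MeasureTheory Set

/-- Comparison principle for the Riccati operator `u ↦ u' + u ^ 2` on a half-line. -/
lemma riccati_comparison {R : ℝ} {f g f' g' : ℝ → ℝ}
    (hf : ContinuousOn f (Ici R)) (hg : ContinuousOn g (Ici R))
    (hf' : ∀ r ∈ Ioi R, HasDerivAt f (f' r) r) (hg' : ∀ r ∈ Ioi R, HasDerivAt g (g' r) r)
    (hfg : ∀ r ∈ Ioi R, f' r + f r ^ 2 ≤ g' r + g r ^ 2) (h₀ : f R ≤ g R) :
    ∀ r ∈ Ici R, f r ≤ g r := by
  have hs : Continuous fun x => f (max R x) + g (max R x) := by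
    have hmax : Continuous fun x : ℝ => max R x := by fun_prop
    exact (hf.comp_continuous hmax fun x => le_max_left R x).add
      (hg.comp_continuous hmax fun x => le_max_left R x)
  set P : ℝ → ℝ := fun r => ∫ x in R..r, (f (max R x) + g (max R x))
  have hP' : ∀ r, HasDerivAt P (f (max R r) + g (max R r)) r := fun r =>
    hs.integral_hasStrictDerivAt R r |>.hasDerivAt
  have hPc : Continuous P := continuous_iff_continuousAt.2 fun r => (hP' r).continuousAt
  have hmono : MonotoneOn (fun r => (g r - f r) * exp (P r)) (Ici R) := by
    refine monotoneOn_of_hasDerivWithinAt_nonneg (convex_Ici R)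
      (f' := fun r => (g' r - f' r) * exp (P r) + (g r - f r) * (exp (P r) * (f r + g r)))
      ((hg.sub hf).mul hPc.rexp.continuousOn) ?_ ?_
    · intro r hr
      rw [interior_Ici] at hr
      have h := hP' r
      rw [max_eq_right (le_of_lt hr)] at h
      exact (((hg' r hr).sub (hf' r hr)).mul h.exp).hasDerivWithinAt
    · intro r hr
      rw [interior_Ici] at hr
      have h : 0 ≤ exp (P r) * (g' r + g r ^ 2 - (f' r + f r ^ 2)) :=
        mul_nonneg (exp_pos _).le (sub_nonneg.2 (hfg r hr))
      linarith
  intro r hr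
  have h : (g R - f R) * exp (P R) ≤ (g r - f r) * exp (P r) := hmono self_mem_Ici hr hr
  have h' := (mul_nonneg (sub_nonneg.2 h₀) (exp_pos (P R)).le).trans h
  exact sub_nonneg.1 (nonneg_of_mul_nonneg_left h' (exp_pos _))

/-- The derivative of the supersolution `δ / √r + 1 / (r + c)`. -/
lemma hasDerivAt_div_sqrt_add_inv (δ c : ℝ) {r : ℝ} (hr : 0 < r) (hc : 0 < r + c) :
    HasDerivAt (fun x => δ / √x + 1 / (x + c))
      (-(δ / (2 * r * √r)) - 1 / (r + c) ^ 2) r := by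
  have hs : 0 < √r := sqrt_pos.2 hr
  have h₁ := (hasDerivAt_const r δ).div (hasDerivAt_sqrt hr.ne') hs.ne'
  have h₂ := (hasDerivAt_const r (1 : ℝ)).div ((hasDerivAt_id r).add_const c) hc.ne'
  refine (h₁.add h₂).congr_deriv ?_
  have hsq : √r ^ 2 = r := sq_sqrt hr.le
  simp only [id]
  rw [hsq]
  field_simp
  ring

/-- A solution of `A' + A ^ 2 ≤ ε / r` with `ε → 0` is eventually below `2 * δ / √r`. -/
lemma eventually_mul_sqrt_lt_of_riccati_le {r₀ : ℝ} {A A' ε : ℝ → ℝ}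
    (hA : ContinuousOn A (Ici r₀)) (hA' : ∀ r ∈ Ioi r₀, HasDerivAt A (A' r) r)
    (hεlim : Tendsto ε atTop (nhds 0)) (hle : ∀ r ∈ Ioi r₀, A' r + A r ^ 2 ≤ ε r / r)
    {δ : ℝ} (hδ : 0 < δ) : ∀ᶠ r in atTop, A r * √r < 2 * δ := by
  obtain ⟨R, hR⟩ := eventually_atTop.1 <|
    (hεlim.eventually_le_const (show (0 : ℝ) < δ ^ 2 / 2 by positivity)).and <|
      (tendsto_sqrt_atTop.eventually_ge_atTop (1 / δ)).and <|
        (eventually_gt_atTop (0 : ℝ)).and (eventually_ge_atTop r₀)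
  have hRr₀ : r₀ ≤ R := (hR R le_rfl).2.2.2
  have hRpos : 0 < R := (hR R le_rfl).2.2.1
  set c : ℝ := 1 / (|A R| + 1) with hc
  have hcpos : 0 < c := by positivity
  have hshift : ∀ r ∈ Ici R, 0 < r + (c - R) := fun r (hr : R ≤ r) => by linarith
  have hder : ∀ r ∈ Ici R, HasDerivAt (fun x => δ / √x + 1 / (x + (c - R)))
      (-(δ / (2 * r * √r)) - 1 / (r + (c - R)) ^ 2) r := fun r hr =>
    hasDerivAt_div_sqrt_add_inv δ _ (hRpos.trans_le hr) (hshift r hr)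
  have hcomp := riccati_comparison (R := R) (hA.mono (Ici_subset_Ici.2 hRr₀))
    (fun r hr => (hder r hr).continuousAt.continuousWithinAt)
    (fun r hr => hA' r (hRr₀.trans_lt hr)) (fun r hr => hder r (Ioi_subset_Ici_self hr))
    (fun r hr => by
      have hrpos : 0 < r := hRpos.trans hr
      obtain ⟨h₁, h₂, -⟩ := hR r (le_of_lt hr)
      have hs : 0 < √r := sqrt_pos.2 hrpos
      have hsq : √r ^ 2 = r := sq_sqrt hrpos.le
      have hd := hshift r (Ioi_subset_Ici_self hr)
      have hδs : 1 ≤ δ * √r := by rwa [div_le_iff₀' hδ] at h₂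
      have hmain : δ ^ 2 / 2 / r ≤ -(δ / (2 * r * √r)) + δ ^ 2 / r := by
        have : -(δ / (2 * r * √r)) + δ ^ 2 / r - δ ^ 2 / 2 / r
            = δ * (δ * √r - 1) / (2 * r * √r) := by
          field_simp
          ring
        have h : 0 ≤ δ * (δ * √r - 1) / (2 * r * √r) :=
          div_nonneg (mul_nonneg hδ.le (sub_nonneg.2 hδs)) (by positivity)
        linarith
      have hcross : 0 ≤ 2 * (δ / √r) * (1 / (r + (c - R))) := by positivity
      have hdsq : (δ / √r) ^ 2 = δ ^ 2 / r := by rw [div_pow, hsq]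
      have hinv : (1 / (r + (c - R))) ^ 2 = 1 / (r + (c - R)) ^ 2 := by
        rw [div_pow, one_pow]
      calc A' r + A r ^ 2 ≤ ε r / r := hle r (hRr₀.trans_lt hr)
        _ ≤ δ ^ 2 / 2 / r := by gcongr
        _ ≤ _ := by
          rw [add_sq (δ / √r), hdsq, hinv]
          linarith)
    (by
      have h₁ : 1 / (R + (c - R)) = |A R| + 1 := by
        rw [add_sub_cancel, hc, one_div_one_div]
      have h₂ : 0 ≤ δ / √R := by positivity
      have h₃ := le_abs_self (A R)
      simp only [h₁]
      linarith)
  filter_upwards [eventually_ge_atTop R, tendsto_sqrt_atTop.eventually_ge_atTop (1 / δ + R),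
    tendsto_sqrt_atTop.eventually_ge_atTop 1] with r hr hr₁ hr₂
  have hrpos : 0 < r := hRpos.trans_le hr
  have hs : 0 < √r := sqrt_pos.2 hrpos
  have hsq : √r * √r = r := mul_self_sqrt hrpos.le
  have hd := hshift r hr
  have h := mul_le_mul_of_nonneg_right (hcomp r hr) hs.le
  have h' : 1 / (r + (c - R)) * √r < δ := by
    rw [one_div_mul_eq_div, div_lt_iff₀ hd]
    have h₁ : 1 ≤ δ * (√r - R) := by
      rw [← div_le_iff₀' hδ]
      linarith
    have h₂ : √r * (√r - R) ≤ r - R := by nlinarith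
    nlinarith [mul_pos hδ hcpos, mul_le_mul_of_nonneg_left h₁ hs.le,
      mul_le_mul_of_nonneg_left h₂ hδ.le]
  rw [add_mul, div_mul_cancel₀ _ hs.ne'] at h
  linarith

/-- Lower Riccati comparison with the shifted model solution `a / (r + s)`. -/
lemma div_add_le_of_le_riccati {r₀ a s : ℝ} (hr₀ : 0 < r₀) (hs : 0 ≤ s) {A A' : ℝ → ℝ}
    (hA : ContinuousOn A (Ici r₀)) (hA' : ∀ r ∈ Ioi r₀, HasDerivAt A (A' r) r)
    (hge : ∀ r ∈ Ioi r₀, a * (a - 1) / (r + s) ^ 2 ≤ A' r + A r ^ 2)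
    (hinit : a / (r₀ + s) ≤ A r₀) : ∀ r ∈ Ici r₀, a / (r + s) ≤ A r := by
  have hpos : ∀ r ∈ Ici r₀, 0 < r + s := fun r (hr : r₀ ≤ r) => by linarith
  have hder : ∀ r ∈ Ici r₀, HasDerivAt (fun x => a / (x + s)) (-a / (r + s) ^ 2) r := by
    intro r hr
    refine ((hasDerivAt_const r a).div ((hasDerivAt_id r).add_const s)
      (hpos r hr).ne').congr_deriv ?_
    simp
  refine riccati_comparison (fun r hr => (hder r hr).continuousAt.continuousWithinAt) hA
    (fun r hr => hder r (Ioi_subset_Ici_self hr)) hA' (fun r hr => ?_) hinit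
  refine le_of_eq_of_le ?_ (hge r hr)
  rw [div_pow, ← add_div]
  ring

/-- Proposition 2.1 of the paper, Riccati (one-dimensional) form. -/
theorem stmt_6
    (r₀ a : ℝ) (hr₀ : 0 < r₀) (ha : 0 < a)
    (A K : ℝ → ℝ)
    (hA : ContDiffOn ℝ 1 A (Ici r₀)) (hK : ContinuousOn K (Ici r₀))
    (hRiccati : ∀ r ∈ Ici r₀, deriv A r + A r ^ 2 = -K r)
    (ε : ℝ → ℝ) (hεpos : ∀ t ∈ Ioi r₀, 0 < ε t)
    (hεlim : Filter.Tendsto ε Filter.atTop (nhds 0))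
    (hKbd : ∀ r ∈ Ici r₀, -(ε r) / r ≤ K r ∧ K r ≤ a * (1 - a) / r ^ 2)
    (hinit₁ : a < 1 → a / r₀ ≤ A r₀)
    (hinit₂ : 1 ≤ a → 0 < A r₀) :
    ∃ C : ℝ, 0 ≤ C ∧ ∃ ε₁ : ℝ → ℝ, (∀ t ∈ Ioi r₀, 0 < ε₁ t) ∧
      Filter.Tendsto ε₁ Filter.atTop (nhds 0) ∧
      ∀ r ∈ Ioi r₀, a / r - C / r ^ 2 ≤ A r ∧ A r ≤ ε₁ r / Real.sqrt r := by
  have hA' : ∀ r ∈ Ioi r₀, HasDerivAt A (deriv A r) r := fun r hr =>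
    ((hA.differentiableOn one_ne_zero).differentiableAt (Ici_mem_nhds hr)).hasDerivAt
  have hKge : ∀ r ∈ Ioi r₀, a * (a - 1) / r ^ 2 ≤ deriv A r + A r ^ 2 := by
    intro r hr
    have h := (hKbd r (Ioi_subset_Ici_self hr)).2
    rw [hRiccati r (Ioi_subset_Ici_self hr), le_neg]
    refine h.trans_eq ?_
    ring
  obtain ⟨s, hs, hlow⟩ : ∃ s : ℝ, 0 ≤ s ∧ ∀ r ∈ Ici r₀, a / (r + s) ≤ A r := by
    rcases lt_or_ge a 1 with h1 | h1
    · exact ⟨0, le_rfl, div_add_le_of_le_riccati hr₀ le_rfl hA.continuousOn hA'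
        (by simpa using hKge) (by simpa using hinit₁ h1)⟩
    · have hA₀ := hinit₂ h1
      have hs : 0 ≤ a / A r₀ := by positivity
      refine ⟨a / A r₀, hs, div_add_le_of_le_riccati hr₀ hs hA.continuousOn hA'
        (fun r hr => le_trans ?_ (hKge r hr)) ?_⟩
      · have hrpos : 0 < r := hr₀.trans hr
        have : 0 ≤ a * (a - 1) := mul_nonneg ha.le (sub_nonneg.2 h1)
        gcongr
        linarith
      · rw [div_le_iff₀ (by positivity), mul_add, mul_div_cancel₀ _ hA₀.ne']
        linarith [mul_pos hA₀ hr₀]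
  have hApos : ∀ r ∈ Ioi r₀, 0 < A r * √r := fun r hr => by
    have hrpos : 0 < r := hr₀.trans hr
    have h : 0 < a / (r + s) := by positivity
    exact mul_pos (h.trans_le (hlow r (Ioi_subset_Ici_self hr))) (sqrt_pos.2 hrpos)
  refine ⟨a * s, by positivity, fun r => A r * √r, hApos, ?_, fun r hr => ⟨?_, ?_⟩⟩
  · refine tendsto_order.2 ⟨fun b hb => ?_, fun b hb => ?_⟩
    · filter_upwards [eventually_gt_atTop r₀] with r hr using hb.trans (hApos r hr)
    · have h := eventually_mul_sqrt_lt_of_riccati_le hA.continuousOn hA' hεlim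
        (fun r hr => ?_) (half_pos hb)
      · filter_upwards [h] with r hr
        linarith
      · rw [hRiccati r (Ioi_subset_Ici_self hr), neg_le, ← neg_div]
        exact (hKbd r (Ioi_subset_Ici_self hr)).1
  · have hrpos : 0 < r := hr₀.trans hr
    refine le_trans ?_ (hlow r (Ioi_subset_Ici_self hr))
    have h : a / (r + s) - (a / r - a * s / r ^ 2) = a * s ^ 2 / (r ^ 2 * (r + s)) := by
      have : r + s ≠ 0 := by positivity
      field_simp
      ring
    have h' : 0 ≤ a * s ^ 2 / (r ^ 2 * (r + s)) := by positivity
    linarith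
  · rw [mul_div_cancel_right₀ _ (sqrt_pos.2 (hr₀.trans hr)).ne']
end

section
/- Let α ∈ (1/2, 1) and k ∈ ℝ, and define f₁ : [1,∞) → (0,∞) by f₁(r) = exp( ∫_1^r ( t^{−α} + k·sin(2t)/t ) dt ). Then f₁ is smooth and positive, lim_{r→∞} f₁'(r)/f₁(r) = 0, and lim_{r→∞} ( r·f₁''(r)/f₁(r) − 2k·cos(2r) ) = 0; in particular the function r ↦ r·f₁''(r)/f₁(r) is bounded on [1,∞), i.e. −f₁''/f₁ = O(1/r) as r → ∞. -/
open Real Filter MeasureTheory Set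

/-- The logarithmic derivative of the warping function. -/
noncomputable def warpRate (α k t : ℝ) : ℝ := t ^ (-α) + k * Real.sin (2 * t) / t

/-- The warping function with logarithmic derivative `warpRate α k`, normalized at `1`. -/
noncomputable def warp (α k r : ℝ) : ℝ := Real.exp (∫ t in (1:ℝ)..r, warpRate α k t)

lemma warp_pos (α k r : ℝ) : 0 < warp α k r := Real.exp_pos _

lemma contDiffOn_warpRate (α k : ℝ) :
    ContDiffOn ℝ (⊤ : ℕ∞) (warpRate α k) (Ioi 0) := by
  unfold warpRate
  intro t ht
  have ht' : t ≠ 0 := (mem_Ioi.1 ht).ne'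
  apply ContDiffAt.contDiffWithinAt
  apply ContDiffAt.add
  · exact Real.contDiffAt_rpow_const_of_ne ht'
  · exact ContDiffAt.div (by fun_prop) contDiffAt_id ht'

lemma hasDerivAt_warpRate (α k : ℝ) {t : ℝ} (ht : 0 < t) :
    HasDerivAt (warpRate α k)
      (-α * t ^ (-α - 1) + k * (2 * Real.cos (2 * t) * t - Real.sin (2 * t)) / t ^ 2) t := by
  have hsin : HasDerivAt (fun t => k * Real.sin (2 * t)) (k * (Real.cos (2 * t) * (2 * 1))) t :=
    (((hasDerivAt_id t).const_mul 2).sin).const_mul k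
  refine ((Real.hasDerivAt_rpow_const (p := -α) (Or.inl ht.ne')).add
    (hsin.div (hasDerivAt_id' t) ht.ne')).congr_deriv ?_
  ring

lemma hasDerivAt_integral_warpRate (α k : ℝ) {r : ℝ} (hr : 0 < r) :
    HasDerivAt (fun r => ∫ t in (1:ℝ)..r, warpRate α k t) (warpRate α k r) r := by
  have hcont := (contDiffOn_warpRate α k).continuousOn
  have hsub : uIcc 1 r ⊆ Ioi 0 := fun t ht => (lt_min one_pos hr).trans_le ht.1
  exact intervalIntegral.integral_hasDerivAt_right (hcont.mono hsub).intervalIntegrable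
    (hcont.stronglyMeasurableAtFilter isOpen_Ioi r hr) (hcont.continuousAt (Ioi_mem_nhds hr))

lemma hasDerivAt_warp (α k : ℝ) {r : ℝ} (hr : 0 < r) :
    HasDerivAt (warp α k) (warp α k r * warpRate α k r) r :=
  (hasDerivAt_integral_warpRate α k hr).exp

lemma contDiffOn_warp (α k : ℝ) : ContDiffOn ℝ (⊤ : ℕ∞) (warp α k) (Ioi 0) := by
  apply ContDiffOn.exp
  rw [contDiffOn_infty_iff_deriv_of_isOpen isOpen_Ioi]
  exact ⟨fun r hr => (hasDerivAt_integral_warpRate α k hr).differentiableAt.differentiableWithinAt,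
    (contDiffOn_warpRate α k).congr fun r hr => (hasDerivAt_integral_warpRate α k hr).deriv⟩

lemma deriv_warp_div (α k : ℝ) {r : ℝ} (hr : 0 < r) :
    deriv (warp α k) r / warp α k r = warpRate α k r := by
  rw [(hasDerivAt_warp α k hr).deriv, mul_div_cancel_left₀ _ (warp_pos α k r).ne']

lemma mul_deriv_deriv_warp_div (α k : ℝ) {r : ℝ} (hr : 0 < r) :
    r * deriv (deriv (warp α k)) r / warp α k r =
      2 * k * Real.cos (2 * r) + (-α * r ^ (-α) - k * Real.sin (2 * r) * r⁻¹
        + (r ^ (1 / 2 - α) + k * Real.sin (2 * r) * r ^ (-(1 / 2) : ℝ)) ^ 2) := by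
  have hev : deriv (warp α k) =ᶠ[nhds r] warp α k * warpRate α k := by
    filter_upwards [Ioi_mem_nhds hr] with s hs using (hasDerivAt_warp α k hs).deriv
  rw [hev.deriv_eq, ((hasDerivAt_warp α k hr).mul (hasDerivAt_warpRate α k hr)).deriv]
  have hw := (warp_pos α k r).ne'
  have hneg : r ^ (-α - 1) = r ^ (-α) / r := Real.rpow_sub_one hr.ne' _
  have hhalf : r ^ (1 / 2 - α) = √r * r ^ (-α) := by
    rw [Real.sqrt_eq_rpow, ← Real.rpow_add hr, sub_eq_add_neg]
  have hinv : r ^ (-(1 / 2) : ℝ) = √r / r := by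
    rw [Real.sqrt_eq_rpow, ← Real.rpow_sub_one hr.ne']
    norm_num
  have hsq : (r ^ (1 / 2 - α) + k * Real.sin (2 * r) * r ^ (-(1 / 2) : ℝ)) ^ 2
      = r * warpRate α k r ^ 2 := by
    rw [hhalf, hinv, warpRate]
    linear_combination (r ^ (-α) + k * Real.sin (2 * r) / r) ^ 2 * Real.sq_sqrt hr.le
  rw [hsq, hneg]
  field_simp
  ring

lemma tendsto_const_mul_sin_mul (k : ℝ) {u : ℝ → ℝ} (hu : Tendsto u atTop (nhds 0)) :
    Tendsto (fun r => k * Real.sin (2 * r) * u r) atTop (nhds 0) := by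
  refine squeeze_zero_norm (a := fun r => |k| * |u r|) (fun r => ?_) ?_
  · rw [Real.norm_eq_abs, abs_mul, abs_mul]
    gcongr
    exact mul_le_of_le_one_right (abs_nonneg k) (Real.abs_sin_le_one _)
  · simpa using hu.abs.const_mul |k|

lemma tendsto_warpRate {α : ℝ} (hα : 0 < α) (k : ℝ) :
    Tendsto (warpRate α k) atTop (nhds 0) := by
  unfold warpRate
  simpa [div_eq_mul_inv] using
    (tendsto_rpow_neg_atTop hα).add (tendsto_const_mul_sin_mul k tendsto_inv_atTop_zero)

lemma tendsto_warp_remainder {α : ℝ} (hα : 1 / 2 < α) (k : ℝ) :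
    Tendsto (fun r : ℝ => -α * r ^ (-α) - k * Real.sin (2 * r) * r⁻¹
        + (r ^ (1 / 2 - α) + k * Real.sin (2 * r) * r ^ (-(1 / 2) : ℝ)) ^ 2) atTop (nhds 0) := by
  have hpow : Tendsto (fun r : ℝ => r ^ (1 / 2 - α)) atTop (nhds 0) := by
    simpa only [neg_sub] using tendsto_rpow_neg_atTop (sub_pos.2 hα)
  have hhalf := tendsto_const_mul_sin_mul k (tendsto_rpow_neg_atTop (one_half_pos (α := ℝ)))
  simpa using (((tendsto_rpow_neg_atTop (one_half_pos.trans hα)).const_mul (-α)).sub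
    (tendsto_const_mul_sin_mul k tendsto_inv_atTop_zero)).add ((hpow.add hhalf).pow 2)

lemma abs_mul_deriv_deriv_warp_div_le {α : ℝ} (hα : 1 / 2 < α) (k : ℝ) {r : ℝ} (hr : 1 ≤ r) :
    |r * deriv (deriv (warp α k)) r / warp α k r| ≤ 2 * |k| + (α + |k| + (1 + |k|) ^ 2) := by
  have hr0 : 0 < r := one_pos.trans_le hr
  have hα0 : 0 < α := one_half_pos.trans hα
  have hpow {p : ℝ} (hp : p ≤ 0) : |r ^ p| ≤ 1 := by
    rw [abs_of_pos (Real.rpow_pos_of_pos hr0 p)]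
    exact Real.rpow_le_one_of_one_le_of_nonpos hr hp
  have hsin {u : ℝ} (hu : |u| ≤ 1) : |k * Real.sin (2 * r) * u| ≤ |k| := by
    rw [mul_assoc, abs_mul, abs_mul]
    exact mul_le_of_le_one_right (abs_nonneg k)
      (mul_le_one₀ (Real.abs_sin_le_one _) (abs_nonneg u) hu)
  have hcos : |2 * k * Real.cos (2 * r)| ≤ 2 * |k| := by
    rw [abs_mul, abs_mul, abs_two]
    exact mul_le_of_le_one_right (by positivity) (Real.abs_cos_le_one _)
  have hα' : |-α * r ^ (-α)| ≤ α := by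
    rw [abs_mul, abs_neg, abs_of_pos hα0]
    exact mul_le_of_le_one_right hα0.le (hpow (by linarith))
  have hinv : |r⁻¹| ≤ 1 := by
    rw [abs_of_pos (inv_pos.2 hr0)]
    exact inv_le_one_of_one_le₀ hr
  rw [mul_deriv_deriv_warp_div α k hr0]
  refine (abs_add_le _ _).trans (add_le_add hcos ((abs_add_le _ _).trans (add_le_add
    ((abs_sub _ _).trans (add_le_add hα' (hsin hinv))) ?_)))
  rw [abs_pow]
  gcongr
  exact (abs_add_le _ _).trans
    (add_le_add (hpow (by linarith)) (hsin (hpow (by norm_num))))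

/-- Analytic properties of the warping function `f₁` used in the proof of
Theorem 1.5 of the paper. -/
theorem stmt_13
    (α k : ℝ) (hα : α ∈ Set.Ioo (1 / 2 : ℝ) 1)
    (f₁ : ℝ → ℝ)
    (hf₁ : f₁ = fun r => Real.exp (∫ t in (1:ℝ)..r, t ^ (-α) + k * Real.sin (2 * t) / t)) :
    ContDiffOn ℝ (⊤ : ℕ∞) f₁ (Ici (1 : ℝ)) ∧
    (∀ r ∈ Ici (1 : ℝ), 0 < f₁ r) ∧
    Filter.Tendsto (fun r => deriv f₁ r / f₁ r) Filter.atTop (nhds 0) ∧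
    Filter.Tendsto
      (fun r => r * deriv (deriv f₁) r / f₁ r - 2 * k * Real.cos (2 * r))
      Filter.atTop (nhds 0) ∧
    ∃ C : ℝ, ∀ r ∈ Ici (1 : ℝ), |r * deriv (deriv f₁) r / f₁ r| ≤ C := by
  obtain rfl : f₁ = warp α k := hf₁
  refine ⟨(contDiffOn_warp α k).mono (Ici_subset_Ioi.2 one_pos),
    fun r _ => warp_pos α k r, ?_, ?_,
    _, fun r hr => abs_mul_deriv_deriv_warp_div_le hα.1 k hr⟩
  · refine (tendsto_warpRate (one_half_pos.trans hα.1) k).congr' ?_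
    filter_upwards [eventually_gt_atTop 0] with r hr using (deriv_warp_div α k hr).symm
  · refine (tendsto_warp_remainder hα.1 k).congr' ?_
    filter_upwards [eventually_gt_atTop 0] with r hr
    rw [mul_deriv_deriv_warp_div α k hr, add_sub_cancel_left]
end
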